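/- Suppose p > 5. For each integer n ≥ 1, let λₙ = 1 + 1/n and define u₀ₙ : ℝ → ℝ by u₀ₙ(x) = λₙ·Q(λₙ²·x). Then for every n ≥ 1: ∫_ℝ u₀ₙ(x)² dx = ∫_ℝ Q(x)² dx and E(u₀ₙ) < E(Q); moreover ‖u₀ₙ − Q‖_{H¹} → 0 as n → ∞. -/

import Mathlib

/-- The soliton profile `Q(x) = ((p+1)/(2 cosh²(((p−1)/2)x)))^(1/(p−1))`. -/
noncomputable def Q (p : ℕ) (x : ℝ) : ℝ :=
  (((p : ℝ) + 1) / (2 * Real.cosh ((((p : ℝ) - 1) / 2) * x) ^ 2)) ^ (1 / ((p : ℝ) - 1))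

/-- The energy `E(φ) = (1/2)∫φ'² − (1/(p+1))∫φ^(p+1)`. -/
noncomputable def E (p : ℕ) (φ : ℝ → ℝ) : ℝ :=
  (1 / 2) * (∫ x : ℝ, deriv φ x ^ 2) - (1 / ((p : ℝ) + 1)) * (∫ x : ℝ, φ x ^ (p + 1))

/-- The `H¹` norm: `‖a‖² = ∫a² + ∫a'²`. -/
noncomputable def H1norm (a : ℝ → ℝ) : ℝ :=
  Real.sqrt ((∫ x : ℝ, a x ^ 2) + ∫ x : ℝ, deriv a x ^ 2)

/-- The initial data `u₀ₙ(x) = λₙ Q(λₙ² x)` with `λₙ = 1 + 1/n`. -/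
noncomputable def u₀ (p : ℕ) (n : ℕ) (x : ℝ) : ℝ :=
  (1 + 1 / (n : ℝ)) * Q p ((1 + 1 / (n : ℝ)) ^ 2 * x)

/-- The derivative of the soliton profile `Q`. -/
noncomputable def derivQ (p : ℕ) (x : ℝ) : ℝ :=
  -Real.tanh ((((p : ℝ) - 1) / 2) * x) * Q p x

theorem Q_pos (p : ℕ) (x : ℝ) : 0 < Q p x := by
  have := Real.cosh_pos ((((p : ℝ) - 1) / 2) * x)
  unfold Q
  positivity

theorem hasDerivAt_tanh_mul (a x : ℝ) :
    HasDerivAt (fun x => Real.tanh (a * x)) (a / Real.cosh (a * x) ^ 2) x := by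
  have hc := (Real.cosh_pos (a * x)).ne'
  have hlin : HasDerivAt (fun x : ℝ => a * x) a x := by
    simpa using (hasDerivAt_id x).const_mul a
  have hq := hlin.sinh.div hlin.cosh hc
  have hfun : (fun x => Real.tanh (a * x)) = fun x => Real.sinh (a * x) / Real.cosh (a * x) := by
    funext y
    exact Real.tanh_eq_sinh_div_cosh _
  rw [hfun]
  refine hq.congr_deriv ?_
  congr 1
  linear_combination a * Real.cosh_sq_sub_sinh_sq (a * x)

theorem hasDerivAt_Q {p : ℕ} (hp : 2 ≤ p) (x : ℝ) : HasDerivAt (Q p) (derivQ p x) x := by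
  have hp' : (0 : ℝ) < (p : ℝ) - 1 := by
    have : (2 : ℝ) ≤ p := by exact_mod_cast hp
    linarith
  set a : ℝ := ((p : ℝ) - 1) / 2 with ha
  have hc := Real.cosh_pos (a * x)
  have hlin : HasDerivAt (fun x : ℝ => a * x) a x := by
    simpa using (hasDerivAt_id x).const_mul a
  have hden : HasDerivAt (fun x => 2 * Real.cosh (a * x) ^ 2)
      (2 * (2 * Real.cosh (a * x) * (Real.sinh (a * x) * a))) x := by
    simpa using (hlin.cosh.pow 2).const_mul 2
  have hbase := (hasDerivAt_const x ((p : ℝ) + 1)).div hden (by positivity)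
  have hpos : 0 < ((p : ℝ) + 1) / (2 * Real.cosh (a * x) ^ 2) := by positivity
  refine (hbase.rpow_const (p := 1 / ((p : ℝ) - 1)) (Or.inl hpos.ne')).congr_deriv ?_
  simp only [Pi.div_apply]
  rw [Real.rpow_sub_one hpos.ne', derivQ, Q, ← ha, Real.tanh_eq_sinh_div_cosh]
  have h2a : (p : ℝ) - 1 = 2 * a := by rw [ha]; ring
  have ha0 : a ≠ 0 := by rw [ha]; positivity
  rw [h2a]
  field_simp
  ring

theorem continuous_Q {p : ℕ} (hp : 2 ≤ p) : Continuous (Q p) :=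
  continuous_iff_continuousAt.2 fun x => (hasDerivAt_Q hp x).continuousAt

theorem continuous_derivQ {p : ℕ} (hp : 2 ≤ p) : Continuous (derivQ p) := by
  have htanh : Continuous fun x : ℝ => Real.tanh ((((p : ℝ) - 1) / 2) * x) :=
    continuous_iff_continuousAt.2 fun x => (hasDerivAt_tanh_mul _ x).continuousAt
  exact htanh.neg.mul (continuous_Q hp)

theorem abs_derivQ_le (p : ℕ) (x : ℝ) : |derivQ p x| ≤ Q p x := by
  rw [derivQ, abs_mul, abs_neg, abs_of_pos (Q_pos p x)]
  exact mul_le_of_le_one_left (Q_pos p x).le (Real.abs_tanh_lt_one _).le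

theorem Q_pow_succ {p : ℕ} (hp : 2 ≤ p) (x : ℝ) :
    Q p x ^ (p + 1) =
      ((p : ℝ) + 1) / (2 * Real.cosh ((((p : ℝ) - 1) / 2) * x) ^ 2) * Q p x ^ 2 := by
  have hp' : (p : ℝ) - 1 ≠ 0 := by
    have : (2 : ℝ) ≤ p := by exact_mod_cast hp
    linarith
  have hsub : ((p - 1 : ℕ) : ℝ) = (p : ℝ) - 1 := by
    rw [Nat.cast_sub (by lia), Nat.cast_one]
  have hpow : Q p x ^ (p - 1) =
      ((p : ℝ) + 1) / (2 * Real.cosh ((((p : ℝ) - 1) / 2) * x) ^ 2) := by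
    rw [Q, ← Real.rpow_natCast, hsub, ← Real.rpow_mul (by positivity),
      one_div_mul_cancel hp', Real.rpow_one]
  rw [← hpow, ← pow_add]
  congr 1
  lia

theorem Q_antitone_abs {p : ℕ} (hp : 2 ≤ p) {x y : ℝ} (h : |x| ≤ |y|) : Q p y ≤ Q p x := by
  have hp' : (0 : ℝ) < (p : ℝ) - 1 := by
    have : (2 : ℝ) ≤ p := by exact_mod_cast hp
    linarith
  have hcx := Real.cosh_pos ((((p : ℝ) - 1) / 2) * x)
  have hcosh : Real.cosh ((((p : ℝ) - 1) / 2) * x) ≤ Real.cosh ((((p : ℝ) - 1) / 2) * y) := by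
    rw [Real.cosh_le_cosh, abs_mul, abs_mul]
    gcongr
  unfold Q
  gcongr

theorem integrable_exp_neg_two_mul_abs :
    MeasureTheory.Integrable fun x : ℝ => Real.exp (-2 * |x|) := by
  rw [← MeasureTheory.integrableOn_univ, ← Set.Iic_union_Ioi (a := (0 : ℝ))]
  refine MeasureTheory.IntegrableOn.union ?_ ?_
  · refine (integrableOn_exp_mul_Iic (a := 2) (by norm_num) 0).congr_fun (fun x hx => ?_)
      measurableSet_Iic
    simp only [abs_of_nonpos (Set.mem_Iic.1 hx)]
    ring_nf
  · refine (integrableOn_exp_mul_Ioi (a := -2) (by norm_num) 0).congr_fun (fun x hx => ?_)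
      measurableSet_Ioi
    simp only [abs_of_pos (Set.mem_Ioi.1 hx)]

theorem Q_le_exp {p : ℕ} (hp : 2 ≤ p) (x : ℝ) :
    Q p x ≤ (2 * ((p : ℝ) + 1)) ^ (1 / ((p : ℝ) - 1)) * Real.exp (-|x|) := by
  have hp' : (0 : ℝ) < (p : ℝ) - 1 := by
    have : (2 : ℝ) ≤ p := by exact_mod_cast hp
    linarith
  set a : ℝ := ((p : ℝ) - 1) / 2 with ha
  have hcosh : Real.exp (a * |x|) / 2 ≤ Real.cosh (a * x) := by
    rw [← Real.cosh_abs, abs_mul, abs_of_pos (show 0 < a by positivity), Real.cosh_eq]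
    linarith [Real.exp_pos (-(a * |x|))]
  have hexp : Real.exp (-|x|) = Real.exp (-(((p : ℝ) - 1) * |x|)) ^ (1 / ((p : ℝ) - 1)) := by
    rw [← Real.exp_mul]
    congr 1
    field_simp
  rw [hexp, ← Real.mul_rpow (by positivity) (by positivity), Q, ← ha]
  refine Real.rpow_le_rpow (by positivity) ?_ (by positivity)
  calc ((p : ℝ) + 1) / (2 * Real.cosh (a * x) ^ 2)
      ≤ ((p : ℝ) + 1) / (2 * (Real.exp (a * |x|) / 2) ^ 2) := by gcongr
    _ = 2 * ((p : ℝ) + 1) * Real.exp (-(((p : ℝ) - 1) * |x|)) := by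
      have h2 : ((p : ℝ) - 1) * |x| = a * |x| + a * |x| := by rw [ha]; ring
      rw [h2, Real.exp_neg, Real.exp_add]
      field_simp
    
theorem integrable_Q_sq {p : ℕ} (hp : 2 ≤ p) : MeasureTheory.Integrable fun x => Q p x ^ 2 := by
  refine (integrable_exp_neg_two_mul_abs.const_mul
    (((2 * ((p : ℝ) + 1)) ^ (1 / ((p : ℝ) - 1))) ^ 2)).mono'
    ((continuous_Q hp).pow 2).aestronglyMeasurable (.of_forall fun x => ?_)
  rw [Real.norm_of_nonneg (by positivity)]
  have hsq : Real.exp (-2 * |x|) = Real.exp (-|x|) ^ 2 := by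
    rw [← Real.exp_nat_mul]
    congr 1
    push_cast
    ring
  rw [hsq, ← mul_pow]
  exact pow_le_pow_left₀ (Q_pos p x).le (Q_le_exp hp x) 2

theorem integrable_Q_pow_succ {p : ℕ} (hp : 2 ≤ p) :
    MeasureTheory.Integrable fun x => Q p x ^ (p + 1) := by
  refine ((integrable_Q_sq hp).const_mul (((p : ℝ) + 1) / 2)).mono'
    ((continuous_Q hp).pow _).aestronglyMeasurable (.of_forall fun x => ?_)
  have hQ := Q_pos p x
  rw [Real.norm_of_nonneg (by positivity), Q_pow_succ hp]
  have hcosh := Real.one_le_cosh ((((p : ℝ) - 1) / 2) * x)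
  gcongr
  nlinarith

theorem integrable_derivQ_sq {p : ℕ} (hp : 2 ≤ p) :
    MeasureTheory.Integrable fun x => derivQ p x ^ 2 := by
  refine (integrable_Q_sq hp).mono'
    ((continuous_derivQ hp).pow 2).aestronglyMeasurable (.of_forall fun x => ?_)
  rw [Real.norm_of_nonneg (by positivity), ← sq_abs]
  exact pow_le_pow_left₀ (abs_nonneg _) (abs_derivQ_le p x) 2

theorem hasDerivAt_Q_mul_derivQ {p : ℕ} (hp : 2 ≤ p) (x : ℝ) :
    HasDerivAt (fun x => Q p x * derivQ p x)
      (2 * derivQ p x ^ 2 - ((p : ℝ) - 1) / ((p : ℝ) + 1) * Q p x ^ (p + 1)) x := by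
  have hQ := hasDerivAt_Q hp x
  have hdQ : HasDerivAt (derivQ p) _ x := (hasDerivAt_tanh_mul (((p : ℝ) - 1) / 2) x).neg.mul hQ
  refine (hQ.mul hdQ).congr_deriv ?_
  rw [Q_pow_succ hp]
  have hc := Real.cosh_pos ((((p : ℝ) - 1) / 2) * x)
  simp only [derivQ, Pi.neg_apply]
  field_simp
  ring

/-- The virial identity relating the kinetic and potential energies of the soliton. -/
theorem two_mul_integral_derivQ_sq {p : ℕ} (hp : 2 ≤ p) :
    2 * ∫ x, derivQ p x ^ 2 = ((p : ℝ) - 1) / ((p : ℝ) + 1) * ∫ x, Q p x ^ (p + 1) := by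
  have h1 := (integrable_derivQ_sq hp).const_mul 2
  have h2 := (integrable_Q_pow_succ hp).const_mul (((p : ℝ) - 1) / ((p : ℝ) + 1))
  have hint : MeasureTheory.Integrable fun x => Q p x * derivQ p x := by
    refine (integrable_Q_sq hp).mono'
      ((continuous_Q hp).mul (continuous_derivQ hp)).aestronglyMeasurable (.of_forall fun x => ?_)
    rw [Real.norm_eq_abs, abs_mul, abs_of_pos (Q_pos p x), sq]
    exact mul_le_mul_of_nonneg_left (abs_derivQ_le p x) (Q_pos p x).le
  have hzero := MeasureTheory.integral_eq_zero_of_hasDerivAt_of_integrable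
    (hasDerivAt_Q_mul_derivQ hp) (h1.sub h2) hint
  rw [MeasureTheory.integral_sub h1 h2, MeasureTheory.integral_const_mul,
    MeasureTheory.integral_const_mul] at hzero
  linarith

theorem integral_Q_pow_succ_pos {p : ℕ} (hp : 2 ≤ p) : 0 < ∫ x, Q p x ^ (p + 1) :=
  (MeasureTheory.integral_pos_iff_support_of_nonneg (fun x => (pow_pos (Q_pos p x) _).le)
    (integrable_Q_pow_succ hp)).2 (by
      have hsupp : (Function.support fun x => Q p x ^ (p + 1)) = Set.univ :=
        Set.eq_univ_of_forall fun x => (pow_pos (Q_pos p x) _).ne'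
      simp [hsupp])

theorem hasDerivAt_rescaled_Q {p : ℕ} (hp : 2 ≤ p) (l x : ℝ) :
    HasDerivAt (fun x => l * Q p (l ^ 2 * x)) (l ^ 3 * derivQ p (l ^ 2 * x)) x := by
  have hlin : HasDerivAt (fun x : ℝ => l ^ 2 * x) (l ^ 2) x := by
    simpa using (hasDerivAt_id x).const_mul (l ^ 2)
  refine (((hasDerivAt_Q hp (l ^ 2 * x)).comp x hlin).const_mul l).congr_deriv ?_
  ring

theorem integral_const_mul_comp_sq_mul_pow (f : ℝ → ℝ) (c l : ℝ) (k : ℕ) :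
    ∫ x, (c * f (l ^ 2 * x)) ^ k = c ^ k / l ^ 2 * ∫ x, f x ^ k := by
  simp only [mul_pow]
  rw [MeasureTheory.integral_const_mul,
    MeasureTheory.Measure.integral_comp_mul_left (fun y => f y ^ k) (l ^ 2),
    abs_of_nonneg (by positivity), smul_eq_mul]
  ring

theorem integral_rescaled_Q_sq (p : ℕ) {l : ℝ} (hl : 0 < l) :
    ∫ x, (l * Q p (l ^ 2 * x)) ^ 2 = ∫ x, Q p x ^ 2 := by
  rw [integral_const_mul_comp_sq_mul_pow, div_self (by positivity), one_mul]

theorem four_mul_pow_sub_one_gt {m : ℕ} (hm : 4 < m) {l : ℝ} (hl : 1 < l) :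
    (m : ℝ) * (l ^ 4 - 1) < 4 * (l ^ m - 1) := by
  have hl4 : 1 < l ^ 4 := one_lt_pow₀ hl (by norm_num)
  have hm' : (1 : ℝ) < m / 4 := by
    have : (4 : ℝ) < m := by exact_mod_cast hm
    linarith
  have hb := one_add_mul_self_lt_rpow_one_add (s := l ^ 4 - 1) (by linarith) (by linarith) hm'
  have hpow : (1 + (l ^ 4 - 1)) ^ ((m : ℝ) / 4) = l ^ m := by
    rw [add_sub_cancel, ← Real.rpow_natCast l 4, ← Real.rpow_mul (by linarith),
      ← Real.rpow_natCast l m]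
    congr 1
    push_cast
    ring
  rw [hpow] at hb
  linarith

theorem E_Q {p : ℕ} (hp : 2 ≤ p) :
    E p (Q p) = 1 / 2 * (∫ x, derivQ p x ^ 2) - 1 / ((p : ℝ) + 1) * ∫ x, Q p x ^ (p + 1) := by
  simp only [E, (hasDerivAt_Q hp _).deriv]

theorem E_rescaled_Q {p : ℕ} (hp : 2 ≤ p) {l : ℝ} (hl : 0 < l) :
    E p (fun x => l * Q p (l ^ 2 * x)) =
      l ^ 4 / 2 * (∫ x, derivQ p x ^ 2) -
        l ^ (p - 1) / ((p : ℝ) + 1) * ∫ x, Q p x ^ (p + 1) := by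
  have hpow : l ^ (p + 1) = l ^ (p - 1) * l ^ 2 := by
    rw [← pow_add]
    congr 1
    lia
  simp only [E, (hasDerivAt_rescaled_Q hp l _).deriv]
  rw [integral_const_mul_comp_sq_mul_pow, integral_const_mul_comp_sq_mul_pow, hpow]
  field_simp

theorem E_rescaled_Q_lt {p : ℕ} (hp : 5 < p) {l : ℝ} (hl : 1 < l) :
    E p (fun x => l * Q p (l ^ 2 * x)) < E p (Q p) := by
  have hp2 : 2 ≤ p := by lia
  rw [E_Q hp2, E_rescaled_Q hp2 (by linarith)]
  have hvir := two_mul_integral_derivQ_sq hp2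
  have hpos := integral_Q_pow_succ_pos hp2
  have hineq := four_mul_pow_sub_one_gt (show 4 < p - 1 by lia) hl
  rw [Nat.cast_sub (by lia), Nat.cast_one] at hineq
  set B := ∫ x, Q p x ^ (p + 1)
  have hA : ∫ x, derivQ p x ^ 2 = ((p : ℝ) - 1) / 2 * (B / ((p : ℝ) + 1)) := by
    linear_combination hvir / 2
  have hB : 0 < B / ((p : ℝ) + 1) := by positivity
  rw [hA, div_mul_eq_mul_div _ ((p : ℝ) + 1), div_mul_eq_mul_div _ ((p : ℝ) + 1),
    mul_div_assoc, mul_div_assoc]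
  nlinarith [mul_lt_mul_of_pos_right hineq hB]

theorem tendsto_integral_rescaled_sub_sq {f g : ℝ → ℝ} (hf : Continuous f) (hfg : ∀ x, |f x| ≤ g x)
    (hg : MeasureTheory.Integrable fun x => g x ^ 2)
    (hmono : ∀ x y, |x| ≤ |y| → g y ≤ g x) {l : ℕ → ℝ}
    (hl : Filter.Tendsto l Filter.atTop (nhds 1)) (hl1 : ∀ n, 1 ≤ l n) (k : ℕ) :
    Filter.Tendsto (fun n => ∫ x, (l n ^ k * f (l n ^ 2 * x) - f x) ^ 2)
      Filter.atTop (nhds 0) := by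
  have hlim : Filter.Tendsto (fun n => ∫ x, (l n ^ k * f (l n ^ 2 * x) - f x) ^ 2)
      Filter.atTop (nhds (∫ _ : ℝ, (0 : ℝ))) := by
    refine MeasureTheory.tendsto_integral_filter_of_dominated_convergence
      (fun x => (2 ^ k + 1) ^ 2 * g x ^ 2) (.of_forall fun n => ?_) ?_ (hg.const_mul _)
      (.of_forall fun x => ?_)
    · have : Continuous fun x => (l n ^ k * f (l n ^ 2 * x) - f x) ^ 2 := by fun_prop
      exact this.aestronglyMeasurable
    · filter_upwards [hl.eventually_le_const (show (1 : ℝ) < 2 by norm_num)] with n hn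
      refine .of_forall fun x => ?_
      have hln := hl1 n
      have hgx : |f (l n ^ 2 * x)| ≤ g x := by
        refine (hfg _).trans (hmono _ _ ?_)
        rw [abs_mul, abs_of_nonneg (sq_nonneg (l n))]
        exact le_mul_of_one_le_left (abs_nonneg x) (one_le_pow₀ hln)
      have hbound : |l n ^ k * f (l n ^ 2 * x) - f x| ≤ (2 ^ k + 1) * g x := by
        calc |l n ^ k * f (l n ^ 2 * x) - f x|
            ≤ |l n ^ k * f (l n ^ 2 * x)| + |f x| := abs_sub _ _
          _ = l n ^ k * |f (l n ^ 2 * x)| + |f x| := by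
            rw [abs_mul, abs_of_nonneg (by positivity)]
          _ ≤ 2 ^ k * g x + g x := by
            gcongr
            exact hfg x
          _ = (2 ^ k + 1) * g x := by ring
      rw [Real.norm_of_nonneg (by positivity), ← sq_abs, ← mul_pow]
      exact pow_le_pow_left₀ (abs_nonneg _) hbound 2
    · have hcont : Continuous fun t : ℝ => (t ^ k * f (t ^ 2 * x) - f x) ^ 2 := by fun_prop
      simpa [Function.comp_def] using (hcont.tendsto 1).comp hl
  simpa using hlim

theorem tendsto_H1norm_rescaled_Q_sub {p : ℕ} (hp : 2 ≤ p) {l : ℕ → ℝ}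
    (hl : Filter.Tendsto l Filter.atTop (nhds 1)) (hl1 : ∀ n, 1 ≤ l n) :
    Filter.Tendsto (fun n => H1norm fun x => l n * Q p (l n ^ 2 * x) - Q p x)
      Filter.atTop (nhds 0) := by
  have hmono : ∀ x y, |x| ≤ |y| → Q p y ≤ Q p x := fun x y => Q_antitone_abs hp
  have h0 := tendsto_integral_rescaled_sub_sq (continuous_Q hp)
    (fun x => (abs_of_pos (Q_pos p x)).le) (integrable_Q_sq hp) hmono hl hl1 1
  have h1 := tendsto_integral_rescaled_sub_sq (continuous_derivQ hp)
    (abs_derivQ_le p) (integrable_Q_sq hp) hmono hl hl1 3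
  have hderiv : ∀ n x, deriv (fun x => l n * Q p (l n ^ 2 * x) - Q p x) x =
      l n ^ 3 * derivQ p (l n ^ 2 * x) - derivQ p x := fun n x =>
    ((hasDerivAt_rescaled_Q hp (l n) x).sub (hasDerivAt_Q hp x)).deriv
  simp only [H1norm, hderiv]
  simpa using (h0.add h1).sqrt

/-- For `p > 5`: `∫ u₀ₙ² = ∫ Q²`, `E(u₀ₙ) < E(Q)` for every `n ≥ 1`, and
`‖u₀ₙ − Q‖_{H¹} → 0` as `n → ∞`. -/
theorem stmt14 (p : ℕ) (hp : 5 < p) :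
    (∀ n : ℕ, 1 ≤ n →
      (∫ x : ℝ, u₀ p n x ^ 2) = (∫ x : ℝ, Q p x ^ 2) ∧ E p (u₀ p n) < E p (Q p)) ∧
    Filter.Tendsto (fun n : ℕ => H1norm (fun x => u₀ p n x - Q p x)) Filter.atTop
      (nhds 0) := by
  have hp2 : 2 ≤ p := by lia
  refine ⟨fun n hn => ?_, ?_⟩
  · have hn' : (0 : ℝ) < n := by exact_mod_cast hn
    have hl : (1 : ℝ) < 1 + 1 / (n : ℝ) := lt_add_of_pos_right 1 (by positivity)
    exact ⟨integral_rescaled_Q_sq p (by linarith), E_rescaled_Q_lt hp hl⟩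
  · refine tendsto_H1norm_rescaled_Q_sub hp2 (l := fun n : ℕ => 1 + 1 / (n : ℝ)) ?_ fun n => ?_
    · simpa using (tendsto_one_div_atTop_nhds_zero_nat (𝕜 := ℝ)).const_add 1
    · exact le_add_of_nonneg_right (by positivity)
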